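/- arXiv:2108.08655 — 2 statements merged into one kernel-verified Lean document; each statement's English description precedes it below -/
import Mathlib

section
/- A priori bounds for the actor-critic iterates: for any fixed T > 0 and N ∈ ℕ, there exists a constant C_T depending only on T (and not on N) such that sup_{(x,a)∈𝒳×𝒜} |Q_k(x,a)| ≤ C_T and sup_{(x,a)∈𝒳×𝒜} |θ_k(x,a)| ≤ C_T for all k ≤ NT. -/
open MeasureTheory Filter Set
open scoped Classical

noncomputable section

def softmaxPol {X A : Type*} [Fintype A] (θ : X → A → ℝ) (x : X) (a : A) : ℝ :=
  Real.exp (θ x a) / ∑ a', Real.exp (θ x a')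

def explorePol {X A : Type*} [Fintype A] (η : ℝ) (θ : X → A → ℝ) (x : X) (a : A) : ℝ :=
  η / (Fintype.card A : ℝ) + (1 - η) * softmaxPol θ x a

def zetaN (N k : ℕ) : ℝ := (1 + (k : ℝ) / (N : ℝ))⁻¹

def etaN (N k : ℕ) : ℝ := (1 + (Real.log ((k : ℝ) / (N : ℝ) + 1)) ^ 2)⁻¹

def zetaT (t : ℝ) : ℝ := (1 + t)⁻¹

def etaT (t : ℝ) : ℝ := (1 + (Real.log (t + 1)) ^ 2)⁻¹

def IsPolicy {X A : Type*} [Fintype A] (f : X → A → ℝ) : Prop :=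
  (∀ x a, 0 ≤ f x a) ∧ ∀ x, ∑ a, f x a = 1

def ptilde {X A : Type*} (γ : ℝ) (p : X → A → X → ℝ) (μ : X → ℝ)
    (x : X) (a : A) (x' : X) : ℝ :=
  γ * p x a x' + (1 - γ) * μ x'

def actorKer {X A : Type*} (γ : ℝ) (p : X → A → X → ℝ) (μ : X → ℝ) (f : X → A → ℝ) :
    X × A → X × A → ℝ :=
  fun ξ ξ' => ptilde γ p μ ξ.1 ξ.2 ξ'.1 * f ξ'.1 ξ'.2

def criticKer {X A : Type*} (p : X → A → X → ℝ) (g : X → A → ℝ) :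
    X × A → X × A → ℝ :=
  fun ξ ξ' => p ξ.1 ξ.2 ξ'.1 * g ξ'.1 ξ'.2

def kpow {S : Type*} [Fintype S] [DecidableEq S] (K : S → S → ℝ) : ℕ → S → S → ℝ
  | 0 => fun ξ ξ' => if ξ = ξ' then 1 else 0
  | n + 1 => fun ξ ξ' => ∑ y, K ξ y * kpow K n y ξ'

def IsStationaryDist {S : Type*} [Fintype S] (K : S → S → ℝ) (d : S → ℝ) : Prop :=
  (∀ ξ, 0 ≤ d ξ) ∧ (∑ ξ, d ξ = 1) ∧ ∀ ξ', d ξ' = ∑ ξ, d ξ * K ξ ξ'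

def pathSum {X A : Type*} [Fintype X] [Fintype A] [DecidableEq X]
    (p : X → A → X → ℝ) : ℕ → X → A → X → ℝ
  | 0 => fun x _ x' => if x = x' then 1 else 0
  | 1 => fun x a x' => p x a x'
  | n + 2 => fun x a x' => ∑ x₁ : X, ∑ a₁ : A, p x a x₁ * pathSum p (n + 1) x₁ a₁ x'

theorem softmaxPol_nonneg {X A : Type*} [Fintype A] (θ : X → A → ℝ) (x : X) (a : A) :
    0 ≤ softmaxPol θ x a := by
  unfold softmaxPol
  positivity

theorem sum_softmaxPol {X A : Type*} [Fintype A] [Nonempty A] (θ : X → A → ℝ) (x : X) :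
    ∑ a, softmaxPol θ x a = 1 := by
  unfold softmaxPol
  rw [← Finset.sum_div]
  exact div_self (Finset.sum_pos (fun a _ => Real.exp_pos _) Finset.univ_nonempty).ne'

theorem softmaxPol_le_one {X A : Type*} [Fintype A] [Nonempty A] (θ : X → A → ℝ) (x : X) (a : A) :
    softmaxPol θ x a ≤ 1 := by
  rw [← sum_softmaxPol θ x]
  exact Finset.single_le_sum (fun b _ => softmaxPol_nonneg θ x b) (Finset.mem_univ a)

theorem explorePol_nonneg {X A : Type*} [Fintype A] {η : ℝ} (h0 : 0 ≤ η) (h1 : η ≤ 1)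
    (θ : X → A → ℝ) (x : X) (a : A) : 0 ≤ explorePol η θ x a :=
  add_nonneg (by positivity) (mul_nonneg (by linarith) (softmaxPol_nonneg θ x a))

theorem sum_explorePol {X A : Type*} [Fintype A] [Nonempty A] (η : ℝ) (θ : X → A → ℝ) (x : X) :
    ∑ a, explorePol η θ x a = 1 := by
  have hA : (Fintype.card A : ℝ) ≠ 0 := by simp
  simp only [explorePol, Finset.sum_add_distrib, ← Finset.mul_sum, sum_softmaxPol,
    Finset.sum_const, Finset.card_univ, nsmul_eq_mul]
  field_simp
  ring

theorem etaN_nonneg (N k : ℕ) : 0 ≤ etaN N k := by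
  unfold etaN
  positivity

theorem etaN_le_one (N k : ℕ) : etaN N k ≤ 1 :=
  inv_le_one_of_one_le₀ (le_add_of_nonneg_right (sq_nonneg _))

theorem zetaN_nonneg (N k : ℕ) : 0 ≤ zetaN N k := by
  unfold zetaN
  positivity

theorem zetaN_le_one (N k : ℕ) : zetaN N k ≤ 1 :=
  inv_le_one_of_one_le₀ (le_add_of_nonneg_right (by positivity))

theorem abs_sum_mul_le_of_weights {ι : Type*} [Fintype ι] {q w : ι → ℝ} {B : ℝ}
    (hw : ∀ i, 0 ≤ w i) (hw1 : ∑ i, w i = 1) (hq : ∀ i, |q i| ≤ B) :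
    |∑ i, q i * w i| ≤ B := by
  calc |∑ i, q i * w i| ≤ ∑ i, |q i * w i| := Finset.abs_sum_le_sum_abs _ _
    _ ≤ ∑ i, B * w i := Finset.sum_le_sum fun i _ => by
        rw [abs_mul, abs_of_nonneg (hw i)]
        exact mul_le_mul_of_nonneg_right (hq i) (hw i)
    _ = B := by rw [← Finset.mul_sum, hw1, mul_one]

theorem exists_abs_le_of_fintype {X A : Type*} [Fintype X] [Fintype A] (f : X → A → ℝ) :
    ∃ B, 0 ≤ B ∧ ∀ x a, |f x a| ≤ B := by
  obtain ⟨B, hB⟩ := Finite.exists_le fun z : X × A => |f z.1 z.2|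
  exact ⟨max B 0, le_max_right _ _, fun x a => (hB (x, a)).trans (le_max_left _ _)⟩

theorem apriori_bounds
    {X A : Type*} [Fintype X] [Fintype A] [Nonempty X] [Nonempty A]
    [DecidableEq X] [DecidableEq A]
    (p : X → A → X → ℝ) (r : X → A → ℝ) (γ α : ℝ)
    (hp0 : ∀ x a x', 0 ≤ p x a x') (hp1 : ∀ x a, ∑ x', p x a x' = 1)
    (hr : ∀ x a, 0 ≤ r x a ∧ r x a ≤ 1) (hγ : 0 < γ ∧ γ < 1) (hα : 0 < α)
    (Q0 θ0 : X → A → ℝ) (T : ℝ) (hT : 0 < T) :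
    ∃ C : ℝ, ∀ N : ℕ, 0 < N →
      ∀ (xc : ℕ → X) (ac : ℕ → A) (xa : ℕ → X) (aa : ℕ → A) (Q θ : ℕ → X → A → ℝ),
      Q 0 = Q0 → θ 0 = θ0 →
      (∀ k x a, Q (k + 1) x a = Q k x a + (α / N) *
        (r (xc k) (ac k) + γ * (∑ a'', Q k (xc (k + 1)) a'' *
            explorePol (etaN N k) (θ k) (xc (k + 1)) a'') - Q k (xc k) (ac k)) *
        (if xc k = x ∧ ac k = a then 1 else 0)) →
      (∀ k x a, θ (k + 1) x a = θ k x a + (zetaN N k / N) *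
        Q k (xa k) (aa k) * (if xa k = x then 1 else 0) *
        ((if aa k = a then 1 else 0) - softmaxPol (θ k) (xa k) a)) →
      ∀ k : ℕ, (k : ℝ) ≤ (N : ℝ) * T →
        (∀ x a, |Q k x a| ≤ C) ∧ (∀ x a, |θ k x a| ≤ C) := by
  obtain ⟨B, hB0, hB⟩ := exists_abs_le_of_fintype Q0
  obtain ⟨D, hD0, hD⟩ := exists_abs_le_of_fintype θ0
  set E : ℝ := (B + 1) * Real.exp (2 * α * T) with hE
  have hE0 : 0 ≤ E := by positivity
  refine ⟨E + (D + T * E), fun N hN xc ac xa aa Q θ hQ0 hθ0 hQ hθ => ?_⟩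
  have hN' : (0 : ℝ) < N := by exact_mod_cast hN
  have hgrowth : ∀ k x a, |Q k x a| ≤ (B + 1) * Real.exp (2 * α / N * k) - 1 := by
    intro k
    induction k with
    | zero =>
      intro x a
      simpa [hQ0] using hB x a
    | succ k ih =>
      intro x a
      set M : ℝ := (B + 1) * Real.exp (2 * α / N * k) - 1 with hM
      have hM0 : 0 ≤ M := (abs_nonneg _).trans (ih x a)
      have hstep : M + α / N * (1 + M + M) ≤
          (B + 1) * Real.exp (2 * α / N * (k + 1 : ℕ)) - 1 := by
        have hexp : (B + 1) * Real.exp (2 * α / N * (k + 1 : ℕ)) =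
            (M + 1) * Real.exp (2 * α / N) := by
          rw [hM, sub_add_cancel, mul_assoc, ← Real.exp_add]
          push_cast
          ring_nf
        have hmul := mul_le_mul_of_nonneg_left (Real.add_one_le_exp (2 * α / N))
          (by linarith : 0 ≤ M + 1)
        have hαN : 0 < α / N := by positivity
        rw [hexp]
        have hring : (M + 1) * (2 * α / N + 1) =
          M + α / N * (1 + M + M) + 1 + α / N := by ring
        linarith
      refine le_trans ?_ hstep
      have hsum := abs_sum_mul_le_of_weights
        (explorePol_nonneg (etaN_nonneg N k) (etaN_le_one N k) (θ k) (xc (k + 1)))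
        (sum_explorePol (etaN N k) (θ k) (xc (k + 1))) (ih (xc (k + 1)))
      have htd : |r (xc k) (ac k) + γ * (∑ a'', Q k (xc (k + 1)) a'' *
          explorePol (etaN N k) (θ k) (xc (k + 1)) a'') - Q k (xc k) (ac k)| ≤ 1 + M + M := by
        refine (abs_sub _ _).trans (add_le_add ((abs_add_le _ _).trans (add_le_add ?_ ?_))
          (ih _ _))
        · rw [abs_of_nonneg (hr _ _).1]
          exact (hr _ _).2
        · rw [abs_mul, abs_of_pos hγ.1]
          exact (mul_le_of_le_one_left (abs_nonneg _) hγ.2.le).trans hsum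
      rw [hQ]
      refine (abs_add_le _ _).trans (add_le_add (ih x a) ?_)
      rw [abs_mul, abs_mul, abs_of_pos (show 0 < α / N by positivity)]
      refine (mul_le_of_le_one_right (by positivity) ?_).trans
        (mul_le_mul_of_nonneg_left htd (by positivity))
      split_ifs <;> simp
  have hQE : ∀ k : ℕ, (k : ℝ) ≤ N * T → ∀ x a, |Q k x a| ≤ E := by
    intro k hk x a
    have harg : 2 * α / N * k ≤ 2 * α * T := by
      rw [div_mul_eq_mul_div, div_le_iff₀ hN']
      nlinarith
    have hexp := mul_le_mul_of_nonneg_left (Real.exp_le_exp.2 harg) (by linarith : 0 ≤ B + 1)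
    linarith [hgrowth k x a]
  have hθE : ∀ k : ℕ, (k : ℝ) ≤ N * T → ∀ x a, |θ k x a| ≤ D + k / N * E := by
    intro k
    induction k with
    | zero =>
      intro _ x a
      simpa [hθ0] using hD x a
    | succ k ih =>
      intro hk x a
      have hk' : (k : ℝ) ≤ N * T := by
        push_cast at hk
        linarith
      have hsplit : D + ((k + 1 : ℕ) : ℝ) / N * E = D + k / N * E + 1 / N * E := by
        push_cast
        ring
      rw [hθ, hsplit]
      refine (abs_add_le _ _).trans (add_le_add (ih hk' x a) ?_)
      have hs0 := softmaxPol_nonneg (θ k) (xa k) a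
      have hs1 := softmaxPol_le_one (θ k) (xa k) a
      have hscore : |(if aa k = a then (1 : ℝ) else 0) - softmaxPol (θ k) (xa k) a| ≤ 1 := by
        rw [abs_le]
        split_ifs <;> constructor <;> linarith
      have hind : |if xa k = x then (1 : ℝ) else 0| ≤ 1 := by
        split_ifs <;> simp
      have hζ : |zetaN N k / N| ≤ 1 / N := by
        rw [abs_of_nonneg (div_nonneg (zetaN_nonneg N k) hN'.le)]
        exact div_le_div_of_nonneg_right (zetaN_le_one N k) hN'.le
      rw [abs_mul, abs_mul, abs_mul]
      refine (mul_le_of_le_one_right (by positivity) hscore).trans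
        ((mul_le_of_le_one_right (by positivity) hind).trans ?_)
      exact mul_le_mul hζ (hQE k hk' _ _) (abs_nonneg _) (by positivity)
  intro k hk
  have hTE : 0 ≤ T * E := by positivity
  refine ⟨fun x a => (hQE k hk x a).trans (by linarith), fun x a => (hθE k hk x a).trans ?_⟩
  have hkT : (k : ℝ) / N ≤ T := by
    rw [div_le_iff₀ hN']
    linarith
  linarith [mul_le_mul_of_nonneg_right hkT hE0]
end
end

section
/- For the tabular softmax policy, the policy gradient has the explicit form ∂J(f_θ)/∂θ(x,a) = σ_μ^{f_θ}(x,a) · A^{f_θ}(x,a) for every state-action pair (x,a), where A^{f_θ}(x,a) = V^{f_θ}(x,a) − V^{f_θ}(x) is the advantage function. -/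
open MeasureTheory Filter Set
open scoped Classical

noncomputable section

theorem softmaxPol_isPolicy {X A : Type*} [Fintype A] [Nonempty A] (θ : X → A → ℝ) :
    IsPolicy (softmaxPol θ) := by
  have hpos (x : X) : 0 < ∑ a, Real.exp (θ x a) :=
    Finset.sum_pos (fun a _ => Real.exp_pos _) Finset.univ_nonempty
  refine ⟨fun x a => div_nonneg (Real.exp_pos _).le (hpos x).le, fun x => ?_⟩
  simp only [softmaxPol]
  rw [← Finset.sum_div, div_self (hpos x).ne']

/-- A weighted average is bounded by any bound on the averaged values. -/
theorem abs_sum_mul_le_of_sum_eq_one {ι : Type*} [Fintype ι] {w v : ι → ℝ} {C : ℝ}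
    (hw : ∀ i, 0 ≤ w i) (hw1 : ∑ i, w i = 1) (hv : ∀ i, |v i| ≤ C) :
    |∑ i, w i * v i| ≤ C :=
  calc |∑ i, w i * v i| ≤ ∑ i, |w i * v i| := Finset.abs_sum_le_sum_abs _ _
    _ ≤ ∑ i, w i * C := Finset.sum_le_sum fun i _ => by
        rw [abs_mul, abs_of_nonneg (hw i)]
        exact mul_le_mul_of_nonneg_left (hv i) (hw i)
    _ = C := by rw [← Finset.sum_mul, hw1, one_mul]

/-- Stability of the Bellman fixed point under a change of policy. -/
theorem bellman_abs_sub_le {X A : Type*} [Fintype X] [Fintype A]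
    {p : X → A → X → ℝ} {r : X → A → ℝ} {γ : ℝ}
    (hp0 : ∀ x a x', 0 ≤ p x a x') (hp1 : ∀ x a, ∑ x', p x a x' = 1)
    (hγ0 : 0 ≤ γ) (hγ1 : γ < 1) {f g : X → A → ℝ} (hg : IsPolicy g) {Qf Qg : X → A → ℝ}
    (hQf : ∀ x a, Qf x a = r x a + γ * ∑ x', p x a x' * ∑ a', f x' a' * Qf x' a')
    (hQg : ∀ x a, Qg x a = r x a + γ * ∑ x', p x a x' * ∑ a', g x' a' * Qg x' a')
    {E : ℝ} (hE0 : 0 ≤ E) (hE : ∀ x, |∑ a, (g x a - f x a) * Qf x a| ≤ E) (x : X) (a : A) :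
    |Qg x a - Qf x a| ≤ γ / (1 - γ) * E := by
  set M := ‖Qg - Qf‖ with hM
  have hentry (x : X) (a : A) : |Qg x a - Qf x a| ≤ M :=
    (norm_le_pi_norm ((Qg - Qf) x) a).trans (norm_le_pi_norm (Qg - Qf) x)
  have hbound (x : X) (a : A) : |Qg x a - Qf x a| ≤ γ * (E + M) := by
    have hdiff : Qg x a - Qf x a = γ * ∑ x', p x a x' *
        (∑ a', (g x' a' - f x' a') * Qf x' a' + ∑ a', g x' a' * (Qg x' a' - Qf x' a')) := by
      rw [hQg x a, hQf x a, add_sub_add_left_eq_sub, ← mul_sub, ← Finset.sum_sub_distrib]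
      congr 1
      refine Finset.sum_congr rfl fun x' _ => ?_
      rw [← mul_sub, ← Finset.sum_sub_distrib, ← Finset.sum_add_distrib]
      congr 1
      exact Finset.sum_congr rfl fun a' _ => by ring
    rw [hdiff, abs_mul, abs_of_nonneg hγ0]
    refine mul_le_mul_of_nonneg_left
      (abs_sum_mul_le_of_sum_eq_one (hp0 x a) (hp1 x a) fun x' => ?_) hγ0
    exact (abs_add_le _ _).trans (add_le_add (hE x')
      (abs_sum_mul_le_of_sum_eq_one (hg.1 x') (hg.2 x') (hentry x')))
  have hM0 : 0 ≤ M := norm_nonneg _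
  have hMle : M ≤ γ * (E + M) := by
    have h0 : 0 ≤ γ * (E + M) := by positivity
    exact (pi_norm_le_iff_of_nonneg h0).2 fun x => (pi_norm_le_iff_of_nonneg h0).2 (hbound x)
  refine (hentry x a).trans ?_
  rw [div_mul_eq_mul_div, le_div_iff₀ (by linarith)]
  linarith

/-- The performance difference identity. -/
theorem performance_difference {X A : Type*} [Fintype X] [Fintype A]
    {p : X → A → X → ℝ} {μ ν : X → ℝ} {r : X → A → ℝ} {γ : ℝ} {f g : X → A → ℝ}
    {Qf Qg : X → A → ℝ}
    (hQf : ∀ x a, Qf x a = r x a + γ * ∑ x', p x a x' * ∑ a', f x' a' * Qf x' a')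
    (hQg : ∀ x a, Qg x a = r x a + γ * ∑ x', p x a x' * ∑ a', g x' a' * Qg x' a')
    (hν : ∀ x, ν x = μ x + γ * ∑ x', ∑ a', ν x' * f x' a' * p x' a' x) :
    ∑ x, μ x * ∑ a, g x a * Qg x a =
      ∑ x, μ x * ∑ a, f x a * Qf x a + ∑ x, ν x * ∑ a, (g x a - f x a) * Qg x a := by
  set D : X → ℝ := fun x => ∑ a, g x a * Qg x a - ∑ a, f x a * Qf x a with hD
  have hQ (x : X) (a : A) : Qg x a - Qf x a = γ * ∑ x', p x a x' * D x' := by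
    rw [hQg x a, hQf x a, add_sub_add_left_eq_sub, ← mul_sub, ← Finset.sum_sub_distrib]
    simp only [hD, mul_sub]
  have hDeq (x : X) : D x = ∑ a, (g x a - f x a) * Qg x a +
      γ * ∑ a, f x a * ∑ x', p x a x' * D x' := by
    rw [Finset.mul_sum, ← Finset.sum_add_distrib]
    simp only [mul_left_comm γ, ← hQ]
    simp only [hD]
    rw [← Finset.sum_sub_distrib]
    exact Finset.sum_congr rfl fun a _ => by ring
  have hswap : ∑ x, (∑ x', ∑ a', ν x' * f x' a' * p x' a' x) * D x =
      ∑ x, ν x * ∑ a, f x a * ∑ x', p x a x' * D x' := by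
    simp only [Finset.sum_mul, Finset.mul_sum]
    rw [Finset.sum_comm]
    refine Finset.sum_congr rfl fun x _ => ?_
    rw [Finset.sum_comm]
    exact Finset.sum_congr rfl fun a _ => Finset.sum_congr rfl fun x' _ => by ring
  have hνD : ∑ x, ν x * D x =
      ∑ x, μ x * D x + γ * ∑ x, ν x * ∑ a, f x a * ∑ x', p x a x' * D x' := by
    rw [← hswap, Finset.mul_sum, ← Finset.sum_add_distrib]
    refine Finset.sum_congr rfl fun x _ => ?_
    conv_lhs => rw [hν x]
    ring
  have hνD' : ∑ x, ν x * D x = ∑ x, ν x * ∑ a, (g x a - f x a) * Qg x a +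
      γ * ∑ x, ν x * ∑ a, f x a * ∑ x', p x a x' * D x' := by
    rw [Finset.mul_sum, ← Finset.sum_add_distrib]
    refine Finset.sum_congr rfl fun x _ => ?_
    conv_lhs => rw [hDeq x]
    ring
  have hμD : ∑ x, μ x * D x =
      ∑ x, μ x * ∑ a, g x a * Qg x a - ∑ x, μ x * ∑ a, f x a * Qf x a := by
    simp only [hD, mul_sub, Finset.sum_sub_distrib]
  linarith

/-- The product rule when one factor vanishes and the other is merely continuous. -/
theorem HasDerivAt.mul_continuousAt_of_eq_zero {h q : ℝ → ℝ} {h' t : ℝ}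
    (hh : HasDerivAt h h' t) (h0 : h t = 0) (hq : ContinuousAt q t) :
    HasDerivAt (fun u => h u * q u) (h' * q t) t := by
  rw [hasDerivAt_iff_tendsto_slope] at hh ⊢
  refine (hh.mul (hq.tendsto.mono_left nhdsWithin_le_nhds)).congr fun u => ?_
  simp only [slope_def_field, h0]
  ring

theorem hasDerivAt_softmaxPol_update {X A : Type*} [Fintype A] [Nonempty A]
    [DecidableEq X] [DecidableEq A] (θ : X → A → ℝ) (x : X) (a : A) (y : X) (b : A) :
    HasDerivAt
      (fun u : ℝ => softmaxPol (fun x' a' => if x' = x ∧ a' = a then u else θ x' a') y b)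
      (if y = x then softmaxPol θ x b * ((if b = a then 1 else 0) - softmaxPol θ x a) else 0)
      (θ x a) := by
  by_cases hy : y = x
  · subst hy
    have hpos : 0 < ∑ a', Real.exp (θ y a') :=
      Finset.sum_pos (fun a _ => Real.exp_pos _) Finset.univ_nonempty
    have hexp (c : A) : HasDerivAt (fun u : ℝ => Real.exp (if c = a then u else θ y c))
        (if c = a then Real.exp (θ y a) else 0) (θ y a) := by
      by_cases hc : c = a
      · simpa [hc] using Real.hasDerivAt_exp (θ y a)
      · simpa [hc] using hasDerivAt_const (θ y a) (Real.exp (θ y c))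
    have hval (c : A) : (if c = a then θ y a else θ y c) = θ y c := by
      split_ifs with hc
      · rw [hc]
      · rfl
    have hsum := HasDerivAt.fun_sum (u := Finset.univ) fun c _ => hexp c
    have hdiv := (hexp b).fun_div hsum (by simpa only [hval] using hpos.ne')
    simp only [softmaxPol, true_and, if_true]
    refine hdiv.congr_deriv ?_
    simp only [hval, Finset.sum_ite_eq', Finset.mem_univ, if_true]
    split_ifs with hb
    · subst hb
      field_simp
    · field_simp
      ring
  · simpa [softmaxPol, hy] using hasDerivAt_const (θ x a) (softmaxPol θ y b)

theorem softmax_policy_gradient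
    {X A : Type*} [Fintype X] [Fintype A] [Nonempty X] [Nonempty A]
    [DecidableEq X] [DecidableEq A]
    (p : X → A → X → ℝ) (μ : X → ℝ) (r : X → A → ℝ) (γ α : ℝ)
    (hp0 : ∀ x a x', 0 ≤ p x a x') (hp1 : ∀ x a, ∑ x', p x a x' = 1)
    (hμ0 : ∀ x, 0 ≤ μ x) (hμ1 : ∑ x, μ x = 1)
    (hr : ∀ x a, 0 ≤ r x a ∧ r x a ≤ 1) (hγ : 0 < γ ∧ γ < 1) (hα : 0 < α)
    (Vq : (X → A → ℝ) → X → A → ℝ)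
    (hVq : ∀ f : X → A → ℝ, IsPolicy f → ∀ x a,
      Vq f x a = r x a + γ * ∑ x', p x a x' * ∑ a', f x' a' * Vq f x' a')
    (J : (X → A → ℝ) → ℝ)
    (hJ : ∀ f : X → A → ℝ, IsPolicy f → J f = ∑ x, μ x * ∑ a, f x a * Vq f x a)
    (nu : (X → A → ℝ) → X → ℝ)
    (hnu : ∀ f : X → A → ℝ, IsPolicy f → ∀ x,
      nu f x = μ x + γ * ∑ x', ∑ a', nu f x' * f x' a' * p x' a' x)
    (θ : X → A → ℝ) :
    ∀ x a, HasDerivAt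
      (fun u : ℝ => J (softmaxPol (fun x' a' => if x' = x ∧ a' = a then u else θ x' a')))
      (nu (softmaxPol θ) x * softmaxPol θ x a *
        (Vq (softmaxPol θ) x a - ∑ a', softmaxPol θ x a' * Vq (softmaxPol θ) x a'))
      (θ x a) := by
  intro x a
  set G : ℝ → X → A → ℝ :=
    fun u => softmaxPol (fun x' a' => if x' = x ∧ a' = a then u else θ x' a') with hG
  set f := softmaxPol θ with hf
  have hGpol (u : ℝ) : IsPolicy (G u) := softmaxPol_isPolicy _
  have hfpol : IsPolicy f := softmaxPol_isPolicy θ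
  have hGθ : G (θ x a) = f := by
    simp only [hG, hf]
    congr 1
    funext x' a'
    split_ifs with h
    · rw [h.1, h.2]
    · rfl
  have hderiv (y : X) (b : A) : HasDerivAt (fun u => G u y b - f y b)
      (if y = x then f x b * ((if b = a then 1 else 0) - f x a) else 0) (θ x a) :=
    (hasDerivAt_softmaxPol_update θ x a y b).sub_const _
  have hcont (y : X) (b : A) : ContinuousAt (fun u => Vq (G u) y b) (θ x a) := by
    have hE : Tendsto (fun u => γ / (1 - γ) * ∑ x', |∑ a', (G u x' a' - f x' a') * Vq f x' a'|)
        (nhds (θ x a)) (nhds 0) := by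
      have hc : ContinuousAt
          (fun u => γ / (1 - γ) * ∑ x', |∑ a', (G u x' a' - f x' a') * Vq f x' a'|) (θ x a) :=
        continuousAt_const.mul (tendsto_finsetSum _ fun x' _ =>
          (tendsto_finsetSum _ fun a' _ =>
            (hderiv x' a').continuousAt.mul continuousAt_const).abs)
      simpa [ContinuousAt, hGθ] using hc
    rw [ContinuousAt, hGθ, tendsto_iff_dist_tendsto_zero]
    refine squeeze_zero (fun _ => dist_nonneg) (fun u => ?_) hE
    rw [Real.dist_eq]
    exact bellman_abs_sub_le hp0 hp1 hγ.1.le hγ.2 (hGpol u) (hVq f hfpol) (hVq _ (hGpol u))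
      (Finset.sum_nonneg fun _ _ => abs_nonneg _)
      (fun x' => Finset.single_le_sum
        (f := fun x' => |∑ a', (G u x' a' - f x' a') * Vq f x' a'|)
        (fun _ _ => abs_nonneg _) (Finset.mem_univ x')) y b
  have hJG : (fun u => J (G u)) = fun u =>
      J f + ∑ y, nu f y * ∑ b, (G u y b - f y b) * Vq (G u) y b := by
    funext u
    rw [hJ _ (hGpol u), hJ f hfpol]
    exact performance_difference (hVq f hfpol) (hVq _ (hGpol u)) (hnu f hfpol)
  rw [hJG]
  have hsum := (HasDerivAt.fun_sum (u := Finset.univ) fun y _ =>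
    (HasDerivAt.fun_sum (u := Finset.univ) fun b _ =>
      (hderiv y b).mul_continuousAt_of_eq_zero (by simp [hGθ]) (hcont y b)).const_mul
        (nu f y)).const_add (J f)
  refine hsum.congr_deriv ?_
  rw [hGθ, Finset.sum_eq_single x (fun y _ hy => by simp [hy]) (by simp), mul_assoc]
  congr 1
  simp only [if_true, mul_sub, sub_mul, Finset.sum_sub_distrib, Finset.mul_sum]
  congr 1
  · simp
  · exact Finset.sum_congr rfl fun b _ => by ring
end
end
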